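/- Let I=(0,1), s∈(0,1), and w∈BV^s(I)∩C^∞(I) with ‖w‖_{L^∞(∂I)}<+∞ (i.e. w has finite boundary values). Define w̃:ℝ→ℝ by w̃=w on I and w̃=0 on ℝ∖I. Then for all small h, ‖τ_h w̃ − w̃‖_{L^1(ℝ)} ≤ |h|^s · [1/(Γ(1−s)(1−s)) + 1/Γ(1+s)] · (TV^s(w) + ‖w‖_{L^∞(∂I)}) + O(|h|), where τ_h w̃(x) := w̃(x+h). -/

import Mathlib

open MeasureTheory Filter Topology ENNReal

noncomputable section

/-- Left-sided Riemann–Liouville derivative of order `r = ⌊r⌋ + s` on `(0,1)`: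
`d^r_L w(x) = (1/Γ(1−s)) (d/dx)^{⌊r⌋+1} ∫_0^x w(t)(x−t)^{−s} dt`. -/
def dL1 (r : ℝ) (w : ℝ → ℝ) (x : ℝ) : ℝ :=
  (1 / Real.Gamma (1 - (r - Nat.floor r))) *
    iteratedDeriv (Nat.floor r + 1)
      (fun y => ∫ t in Set.Ioo 0 y, w t * (y - t) ^ (-(r - Nat.floor r))) x

/-- Right-sided Riemann–Liouville derivative of order `r = ⌊r⌋ + s` on `(0,1)`:
`d^r_R w(x) = ((−1)^{⌊r⌋+1}/Γ(1−s)) (d/dx)^{⌊r⌋+1} ∫_x^1 w(t)(t−x)^{−s} dt`. -/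
def dR1 (r : ℝ) (w : ℝ → ℝ) (x : ℝ) : ℝ :=
  ((-1 : ℝ) ^ (Nat.floor r + 1) / Real.Gamma (1 - (r - Nat.floor r))) *
    iteratedDeriv (Nat.floor r + 1)
      (fun y => ∫ t in Set.Ioo y 1, w t * (t - y) ^ (-(r - Nat.floor r))) x

/-- The `r`-order total variation on `I = (0,1)`:
`TV^r(w) = sup { ∫_I w · d^r_R φ : φ ∈ C_c^∞(I), ‖φ‖_∞ ≤ 1 }`. -/
def TV1 (r : ℝ) (w : ℝ → ℝ) : ℝ≥0∞ :=
  ⨆ φ : {φ : ℝ → ℝ // ContDiff ℝ (⊤ : ℕ∞) φ ∧ HasCompactSupport φ ∧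
      tsupport φ ⊆ Set.Ioo 0 1 ∧ ∀ x, |φ x| ≤ 1},
    ENNReal.ofReal (∫ x in Set.Ioo (0:ℝ) 1, w x * dR1 r φ.1 x)

/-- `w ∈ SV^r(I)`: strict limit of functions smooth on `I`. -/
def MemSV1 (r : ℝ) (w : ℝ → ℝ) : Prop :=
  IntegrableOn w (Set.Ioo 0 1) ∧
  ∃ v : ℕ → ℝ → ℝ,
    (∀ n, ContDiffOn ℝ (⊤ : ℕ∞) (v n) (Set.Ioo 0 1) ∧ IntegrableOn (v n) (Set.Ioo 0 1)) ∧
    Tendsto (fun n => ∫ x in Set.Ioo (0:ℝ) 1, |v n x - w x|) atTop (𝓝 0) ∧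
    Tendsto (fun n => TV1 r (v n)) atTop (𝓝 (TV1 r w))

/-- Left-sided Caputo derivative of order `s ∈ (0,1)` on `(0,1)`:
`d^s_c φ(x) = (1/Γ(1−s)) ∫_0^x φ'(t)(x−t)^{−s} dt`. -/
def caputo (s : ℝ) (φ : ℝ → ℝ) (x : ℝ) : ℝ :=
  (1 / Real.Gamma (1 - s)) * ∫ t in Set.Ioo 0 x, deriv φ t * (x - t) ^ (-s)


/-- Convolution of real functions on the line. -/
def cv (f g : ℝ → ℝ) : ℝ → ℝ :=
  MeasureTheory.convolution f g (ContinuousLinearMap.mul ℝ ℝ) volume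

lemma cv_apply (f g : ℝ → ℝ) (x : ℝ) : cv f g x = ∫ t, f t * g (x - t) := rfl

lemma cv_swap (f g : ℝ → ℝ) (x : ℝ) : cv f g x = ∫ t, f (x - t) * g t :=
  convolution_mul_swap

lemma cv_comm (f g : ℝ → ℝ) : cv f g = cv g f := by
  ext x; rw [cv_swap, cv_apply]; simp_rw [mul_comm]

lemma cv_integrable {f g : ℝ → ℝ} (hf : Integrable f) (hg : Integrable g) :
    Integrable (cv f g) := hf.integrable_convolution _ hg

lemma cv_integrand_int {f g : ℝ → ℝ} {M : ℝ} (hf : Integrable f)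
    (hg : AEStronglyMeasurable g volume) (hM : ∀ x, |g x| ≤ M) (x : ℝ) :
    Integrable (fun t => f t * g (x - t)) := by
  refine hf.mul_bdd (c := M) ?_ ?_
  · exact hg.comp_quasiMeasurePreserving (quasiMeasurePreserving_sub_left volume x)
  · exact Eventually.of_forall fun t => hM _

lemma cv_bound {f g : ℝ → ℝ} {M : ℝ} (hf : Integrable f)
     (hM : ∀ x, |g x| ≤ M) (x : ℝ) :
    |cv f g x| ≤ (∫ t, |f t|) * M := by
  rw [cv_apply, ← integral_mul_const]
  rw [← Real.norm_eq_abs]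
  refine norm_integral_le_of_norm_le (hf.abs.mul_const M) (Eventually.of_forall fun t => ?_)
  rw [norm_mul]
  exact mul_le_mul_of_nonneg_left (hM _) (norm_nonneg _)

lemma cv_assoc {f g k : ℝ → ℝ} {M : ℝ} (hf : Integrable f) (hg : Integrable g)
    (hk : Integrable k) (hM : ∀ x, |k x| ≤ M) (x : ℝ) :
    cv (cv f g) k x = cv f (cv g k) x := by
  unfold cv
  refine convolution_assoc (ContinuousLinearMap.mul ℝ ℝ) (ContinuousLinearMap.mul ℝ ℝ)
    (ContinuousLinearMap.mul ℝ ℝ) (ContinuousLinearMap.mul ℝ ℝ) (fun x y z => by simp [mul_assoc]) hf.1 hg.1 hk.1 ?_ ?_ ?_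
  · exact hf.ae_convolution_exists _ hg
  · exact hg.norm.ae_convolution_exists _ hk.norm
  · have := cv_integrand_int (f := fun x => ‖f x‖) (g := cv (fun x => ‖g x‖) (fun x => ‖k x‖))
      (M := (∫ t, |‖g t‖|) * M) hf.norm (cv_integrable hg.norm hk.norm).1
      (cv_bound hg.norm (fun x => by simpa using hM x)) x
    exact this

lemma integral_cv {f g : ℝ → ℝ} (hf : Integrable f) (hg : Integrable g) :
    ∫ x, cv f g x = (∫ x, f x) * ∫ x, g x := by
  unfold cv
  rw [integral_convolution _ hf hg]; rfl

/-- Truncated power kernel. -/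
def pker (p : ℝ) : ℝ → ℝ := (Set.Ioo (0:ℝ) 2).indicator (fun u => u ^ p)

lemma pker_nonneg (p u : ℝ) : 0 ≤ pker p u := by
  unfold pker
  exact Set.indicator_nonneg (fun x hx => Real.rpow_nonneg hx.1.le _) _

lemma pker_of_mem {p u : ℝ} (h : 0 < u) (h2 : u < 2) : pker p u = u ^ p := by
  unfold pker; exact Set.indicator_of_mem (show u ∈ Set.Ioo (0:ℝ) 2 from ⟨h, h2⟩) _

lemma pker_of_nonpos {p u : ℝ} (h : u ≤ 0) : pker p u = 0 := by
  unfold pker; exact Set.indicator_of_notMem (fun h' => absurd h'.1 (not_lt.2 h)) _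

lemma pker_of_ge {p u : ℝ} (h : 2 ≤ u) : pker p u = 0 := by
  unfold pker; exact Set.indicator_of_notMem (fun h' => absurd h'.2 (not_lt.2 h)) _

lemma pker_integrable {p : ℝ} (hp : -1 < p) : Integrable (pker p) := by
  unfold pker
  rw [integrable_indicator_iff measurableSet_Ioo]
  have := intervalIntegral.intervalIntegrable_rpow' (a := 0) (b := 2) hp
  rw [intervalIntegrable_iff_integrableOn_Ioo_of_le (by norm_num)] at this
  exact this

lemma pker_setIntegral {p : ℝ} (hp : -1 < p) {y : ℝ} (hy : 0 < y) :
    ∫ u in Set.Ioc 0 y, pker p u ≤ y ^ (p + 1) / (p + 1) := by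
  have h1 : ∫ u in Set.Ioc 0 y, u ^ p = y ^ (p + 1) / (p + 1) := by
    rw [← intervalIntegral.integral_of_le hy.le, integral_rpow (Or.inl hp)]
    rw [Real.zero_rpow (by linarith)]; simp
  rw [← h1]
  refine setIntegral_mono_on (pker_integrable hp).integrableOn ?_ measurableSet_Ioc ?_
  · have := intervalIntegral.intervalIntegrable_rpow' (a := 0) (b := y) hp
    rwa [intervalIntegrable_iff_integrableOn_Ioc_of_le hy.le] at this
  · intro u hu
    unfold pker
    exact Set.indicator_le_self' (fun x hx => Real.rpow_nonneg hu.1.le _) _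

lemma pker_antitone {p : ℝ} (hp : p < 0) {u z : ℝ} (hu : 0 < u) (huz : u ≤ z) :
    pker p z ≤ pker p u := by
  by_cases hz : z < 2
  · rw [pker_of_mem (hu.trans_le huz) hz, pker_of_mem hu (huz.trans_lt hz)]
    exact Real.rpow_le_rpow_of_nonpos hu huz hp.le
  · rw [pker_of_ge (not_lt.1 hz)]; exact pker_nonneg _ _

/-- L¹ modulus of continuity of the kernel. -/
lemma pker_translate {p : ℝ} (hp : -1 < p) (hp0 : p < 0) {h : ℝ} (hh : 0 < h) :
    ∫ z, |pker p (z + h) - pker p z| ≤ 2 * (h ^ (p + 1) / (p + 1)) := by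
  have hi := pker_integrable hp
  have hih : Integrable (fun z => pker p (z + h)) := hi.comp_add_right h
  have hd : Integrable (fun z => |pker p (z + h) - pker p z|) := (hih.sub hi).abs
  rw [← integral_add_compl (measurableSet_Ioi (a := (0:ℝ))) hd]
  have shift : ∀ S : Set ℝ, MeasurableSet S →
      ∫ z in (fun z => z + h) ⁻¹' S, pker p (z + h) = ∫ z in S, pker p z := by
    intro S hS
    rw [← integral_indicator hS, ← integral_indicator (hS.preimage (measurable_add_const h)),
      ← integral_add_right_eq_self (fun z => S.indicator (pker p) z) h]
    rfl
  have e1 : ∫ z in Set.Ioi 0, |pker p (z + h) - pker p z| = ∫ u in Set.Ioc 0 h, pker p u := by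
    have : ∫ z in Set.Ioi 0, |pker p (z + h) - pker p z|
        = ∫ z in Set.Ioi 0, (pker p z - pker p (z + h)) := by
      refine setIntegral_congr_fun measurableSet_Ioi fun z hz => ?_
      have := pker_antitone hp0 (u := z) (z := z + h) hz (by linarith)
      show |_| = _
      rw [abs_sub_comm, abs_of_nonneg (by linarith)]
    rw [this, integral_sub hi.integrableOn hih.integrableOn]
    have e := shift (Set.Ioi h) measurableSet_Ioi
    have : (fun z => z + h) ⁻¹' (Set.Ioi h) = Set.Ioi 0 := by ext z; simp
    rw [this] at e
    rw [e, ← Set.Ioc_union_Ioi_eq_Ioi hh.le, setIntegral_union (by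
      rw [Set.disjoint_left]; intro a ha hb; exact absurd ha.2 (not_le.2 hb)) measurableSet_Ioi
      hi.integrableOn hi.integrableOn]
    ring
  have e2 : ∫ z in (Set.Ioi 0)ᶜ, |pker p (z + h) - pker p z| = ∫ u in Set.Ioc 0 h, pker p u := by
    have : ∫ z in (Set.Ioi 0)ᶜ, |pker p (z + h) - pker p z|
        = ∫ z in Set.Iic 0, pker p (z + h) := by
      rw [Set.compl_Ioi]
      refine setIntegral_congr_fun measurableSet_Iic fun z hz => ?_
      show |_| = _
      rw [pker_of_nonpos (u := z) hz, sub_zero, abs_of_nonneg (pker_nonneg _ _)]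
    rw [this]
    have e := shift (Set.Iic h) measurableSet_Iic
    have : (fun z => z + h) ⁻¹' (Set.Iic h) = Set.Iic 0 := by ext z; simp
    rw [this] at e
    rw [e, ← Set.Iic_union_Ioc_eq_Iic hh.le, setIntegral_union (by
      rw [Set.disjoint_left]; intro a ha hb; exact absurd ha (not_le.2 hb.1)) measurableSet_Ioc
      hi.integrableOn hi.integrableOn]
    rw [setIntegral_eq_zero_of_forall_eq_zero (t := Set.Iic 0) (f := pker p) (fun x hx => pker_of_nonpos hx), zero_add]
  rw [e1, e2]
  have := pker_setIntegral hp hh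
  linarith

/-- The truncated kernels convolve to a constant. -/
lemma pker_beta {s : ℝ} (hs : 0 < s) (hs1 : s < 1) :
    ∃ B > 0, ∀ z, 0 < z → z < 2 → cv (pker (s - 1)) (pker (-s)) z = B := by
  have key : ∀ z, 0 < z → z < 2 → cv (pker (s - 1)) (pker (-s)) z
      = ∫ y in (0:ℝ)..1, y ^ (s - 1) * (1 - y) ^ (-s) := by
    intro z hz hz2
    have h1 : cv (pker (s - 1)) (pker (-s)) z
        = ∫ t in (0:ℝ)..z, t ^ (s - 1) * (z - t) ^ (-s) := by
      rw [cv_apply, intervalIntegral.integral_of_le hz.le, integral_Ioc_eq_integral_Ioo,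
        ← integral_indicator measurableSet_Ioo]
      congr 1; ext t
      by_cases ht : t ∈ Set.Ioo 0 z
      · rw [Set.indicator_of_mem ht, pker_of_mem ht.1 (ht.2.trans hz2),
          pker_of_mem (by linarith [ht.2]) (by linarith [ht.1])]
      · rw [Set.indicator_of_notMem ht]
        by_cases h0 : 0 < t
        · rw [pker_of_nonpos (u := z - t), mul_zero]
          by_contra hc; exact ht ⟨h0, by linarith⟩
        · rw [pker_of_nonpos (u := t) (not_lt.1 h0), zero_mul]
    have h2 := intervalIntegral.integral_comp_mul_left (a := 0) (b := 1)
      (fun t => t ^ (s - 1) * (z - t) ^ (-s)) hz.ne'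
    rw [mul_zero, mul_one] at h2
    rw [h1]
    have h3 : ∫ t in (0:ℝ)..z, t ^ (s - 1) * (z - t) ^ (-s)
       = z * ∫ x in (0:ℝ)..1, (z * x) ^ (s - 1) * (z - z * x) ^ (-s) := by
      rw [h2, smul_eq_mul]; field_simp
    rw [h3, ← intervalIntegral.integral_const_mul]
    refine intervalIntegral.integral_congr fun y hy => ?_
    rw [Set.uIcc_of_le zero_le_one] at hy
    show z * ((z * y) ^ (s - 1) * (z - z * y) ^ (-s)) = _
    rw [show z - z * y = z * (1 - y) by ring, Real.mul_rpow hz.le hy.1,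
      Real.mul_rpow hz.le (by linarith [hy.2])]
    have : z * (z ^ (s - 1) * z ^ (-s)) = 1 := by
      rw [← Real.rpow_add hz]
      nth_rewrite 1 [← Real.rpow_one z]
      rw [← Real.rpow_add hz]; ring_nf; simp
    linear_combination (y ^ (s - 1) * (1 - y) ^ (-s)) * this
  refine ⟨_, ?_, key⟩
  -- positivity
  rw [intervalIntegral.integral_of_le zero_le_one, integral_Ioc_eq_integral_Ioo]
  have hIntg : IntegrableOn (fun y : ℝ => y ^ (s - 1) * (1 - y) ^ (-s)) (Set.Ioo 0 1) := by
    have hb := Complex.betaIntegral_convergent (u := (s : ℂ)) (v := ((1 - s : ℝ) : ℂ))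
      (by simpa using hs) (by simpa using hs1)
    rw [intervalIntegrable_iff_integrableOn_Ioo_of_le zero_le_one] at hb
    refine (integrableOn_congr_fun (fun y hy => ?_) measurableSet_Ioo).1 hb.norm
    have hy1 : 0 < 1 - y := by linarith [hy.2]
    have e1 : (1 : ℂ) - (y : ℂ) = ((1 - y : ℝ) : ℂ) := by push_cast; ring
    simp only [norm_mul]
    rw [e1, Complex.norm_cpow_eq_rpow_re_of_pos hy.1, Complex.norm_cpow_eq_rpow_re_of_pos hy1]
    simp
  refine (setIntegral_pos_iff_support_of_nonneg_ae ?_ hIntg).2 ?_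
  rotate_left
  · have : Set.Ioo (0:ℝ) 1 ⊆ Function.support (fun y : ℝ => y ^ (s - 1) * (1 - y) ^ (-s)) ∩ Set.Ioo 0 1 := by
      intro y hy
      refine ⟨?_, hy⟩
      exact (mul_pos (Real.rpow_pos_of_pos hy.1 _) (Real.rpow_pos_of_pos (by linarith [hy.2]) _)).ne'
    refine lt_of_lt_of_le ?_ (measure_mono this)
    simp
  · filter_upwards [ae_restrict_mem measurableSet_Ioo] with y hy
    exact mul_nonneg (Real.rpow_nonneg hy.1.le _) (Real.rpow_nonneg (by linarith [hy.2]) _)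

/-- A smooth even mollifier of radius `r`. -/
structure Mol (r : ℝ) (ρ : ℝ → ℝ) : Prop where
  smooth : ContDiff ℝ (⊤ : ℕ∞) ρ
  nonneg : ∀ x, 0 ≤ ρ x
  even : ∀ x, ρ (-x) = ρ x
  supp : ∀ x, r ≤ |x| → ρ x = 0
  int : ∫ x, ρ x = 1

lemma Mol.compact {r : ℝ} {ρ : ℝ → ℝ} (h : Mol r ρ) : HasCompactSupport ρ := by
  refine HasCompactSupport.intro (isCompact_Icc (a := -r) (b := r)) fun x hx => h.supp x ?_
  by_contra hc
  rw [not_le, abs_lt] at hc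
  exact hx ⟨hc.1.le, hc.2.le⟩

lemma Mol.integrable {r : ℝ} {ρ : ℝ → ℝ} (h : Mol r ρ) : Integrable ρ :=
  h.smooth.continuous.integrable_of_hasCompactSupport h.compact

lemma Mol.one {r : ℝ} {ρ : ℝ → ℝ} (h : Mol r ρ) : ContDiff ℝ 1 ρ :=
  h.smooth.of_le (by exact_mod_cast le_top)

lemma Mol.deriv_cont {r : ℝ} {ρ : ℝ → ℝ} (h : Mol r ρ) : Continuous (deriv ρ) :=
  h.one.continuous_deriv le_rfl

lemma Mol.deriv_integrable {r : ℝ} {ρ : ℝ → ℝ} (h : Mol r ρ) : Integrable (deriv ρ) :=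
  h.deriv_cont.integrable_of_hasCompactSupport h.compact.deriv

lemma Mol.deriv_supp {r : ℝ} {ρ : ℝ → ℝ} (h : Mol r ρ) (x : ℝ) (hx : r < |x|) :
    deriv ρ x = 0 := by
  have : ρ =ᶠ[𝓝 x] fun _ => 0 := by
    filter_upwards [(isOpen_lt continuous_const continuous_abs).mem_nhds hx] with y hy
    exact h.supp y (le_of_lt hy)
  rw [this.deriv_eq]; simp

lemma Mol.deriv_odd {r : ℝ} {ρ : ℝ → ℝ} (h : Mol r ρ) (x : ℝ) :
    deriv ρ (-x) = - deriv ρ x := by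
  have h1 : (fun x => ρ (-x)) = ρ := funext h.even
  have h2 := deriv_comp_neg ρ x
  rw [h1] at h2
  linarith

lemma exists_mol : ∃ D > 0, ∀ r > 0, ∃ ρ, Mol r ρ ∧ ∀ x, |deriv ρ x| ≤ D / r ^ 2 := by
  let b : ContDiffBump (0:ℝ) := ⟨1/2, 1, by norm_num, by norm_num⟩
  set ρ := b.normed volume with hρ
  have hsm : ContDiff ℝ (⊤ : ℕ∞) ρ := b.contDiff_normed
  have hc : HasCompactSupport ρ := b.hasCompactSupport_normed
  have hdc : Continuous (deriv ρ) :=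
    (hsm.of_le (by exact_mod_cast le_top) : ContDiff ℝ 1 ρ).continuous_deriv le_rfl
  obtain ⟨D, hD⟩ := hc.deriv.exists_bound_of_continuous hdc
  refine ⟨max D 1, by positivity, fun r hr => ⟨fun x => r⁻¹ * ρ (r⁻¹ * x), ⟨?_, ?_, ?_, ?_, ?_⟩, ?_⟩⟩
  · fun_prop
  · intro x; exact mul_nonneg (by positivity) (b.nonneg_normed _)
  · intro x
    have := b.normed_neg (μ := volume) (r⁻¹ * x)
    simp only [mul_neg]; rw [hρ, this]
  · intro x hx
    have : ρ (r⁻¹ * x) = 0 := by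
      rw [← Function.notMem_support, hρ, b.support_normed_eq, Metric.mem_ball, dist_zero_right,
        norm_mul, Real.norm_eq_abs, Real.norm_eq_abs, abs_of_pos (inv_pos.2 hr), not_lt]
      show 1 ≤ _
      rw [inv_mul_eq_div, le_div_iff₀ hr]; linarith
    show r⁻¹ * ρ (r⁻¹ * x) = 0
    rw [this, mul_zero]
  · rw [integral_const_mul, Measure.integral_comp_mul_left, b.integral_normed]
    simp [abs_of_pos hr]; field_simp
  · intro x
    have : HasDerivAt (fun x => r⁻¹ * ρ (r⁻¹ * x)) (r⁻¹ * (deriv ρ (r⁻¹ * x) * (r⁻¹ * 1))) x := by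
      refine HasDerivAt.const_mul _ ?_
      have h1 : HasDerivAt ρ (deriv ρ (r⁻¹ * x)) (r⁻¹ * x) :=
        (hsm.differentiable (by simp)).differentiableAt.hasDerivAt
      exact h1.comp x ((hasDerivAt_id x).const_mul _)
    rw [this.deriv]
    have e : r⁻¹ * (deriv ρ (r⁻¹ * x) * (r⁻¹ * 1)) = deriv ρ (r⁻¹ * x) / r ^ 2 := by
      field_simp
    rw [e, abs_div, abs_of_pos (show 0 < r ^ 2 by positivity)]
    gcongr
    exact (hD _).trans (le_max_left _ _)

/-- Standing assumptions on the extended function. -/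
structure Good (M : ℝ) (v : ℝ → ℝ) : Prop where
  meas : Measurable v
  bdd : ∀ x, |v x| ≤ M
  left : ∀ x, x ≤ 0 → v x = 0
  right : ∀ x, 1 ≤ x → v x = 0

lemma Good.M_nonneg {M : ℝ} {v : ℝ → ℝ} (h : Good M v) : 0 ≤ M := (abs_nonneg _).trans (h.bdd 0)

lemma Good.integrable {M : ℝ} {v : ℝ → ℝ} (h : Good M v) : Integrable v := by
  have : IntegrableOn v (Set.Icc 0 1) := by
    refine Measure.integrableOn_of_bounded (M := M) (by simp) h.meas.aestronglyMeasurable ?_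
    exact Eventually.of_forall h.bdd
  rw [← integrable_indicator_iff measurableSet_Icc] at this
  refine this.congr (Eventually.of_forall fun x => ?_)
  by_cases hx : x ∈ Set.Icc (0:ℝ) 1
  · rw [Set.indicator_of_mem hx]
  · rw [Set.indicator_of_notMem hx]
    by_cases h0 : 0 ≤ x
    · exact (h.right x (by by_contra hc; exact hx ⟨h0, by linarith⟩)).symm
    · exact (h.left x (by linarith)).symm

lemma J_zero {M : ℝ} {v : ℝ → ℝ} (h : Good M v) {p y : ℝ} (hy : y ≤ 0) : cv (pker p) v y = 0 := by
  rw [cv_apply]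
  refine integral_eq_zero_of_ae (Eventually.of_forall fun t => ?_)
  show pker p t * v (y - t) = 0
  by_cases ht : 0 < t
  · rw [h.left _ (by linarith), mul_zero]
  · rw [pker_of_nonpos (not_lt.1 ht), zero_mul]

lemma J_bound {M : ℝ} {v : ℝ → ℝ} (h : Good M v) {p y R : ℝ} (hp : -1 < p) (hR : 0 < R)
    (hy : y ≤ R) : |cv (pker p) v y| ≤ M * (R ^ (p + 1) / (p + 1)) := by
  have hk := pker_integrable hp
  have h1 : |cv (pker p) v y| ≤ ∫ t, (Set.Ioc 0 R).indicator (fun t => M * pker p t) t := by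
    rw [cv_apply, ← Real.norm_eq_abs]
    refine norm_integral_le_of_norm_le ?_ (Eventually.of_forall fun t => ?_)
    · exact (hk.const_mul M).indicator measurableSet_Ioc
    · by_cases ht : t ∈ Set.Ioc 0 R
      · rw [Set.indicator_of_mem ht, norm_mul, mul_comm M, Real.norm_eq_abs, Real.norm_eq_abs,
          abs_of_nonneg (pker_nonneg _ _)]
        exact mul_le_mul_of_nonneg_left (h.bdd _) (pker_nonneg _ _)
      · rw [Set.indicator_of_notMem ht]
        by_cases h0 : 0 < t
        · have : R < t := by by_contra hc; exact ht ⟨h0, by linarith⟩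
          rw [h.left _ (by linarith)]; simp
        · rw [pker_of_nonpos (not_lt.1 h0)]; simp
  refine h1.trans ?_
  rw [integral_indicator measurableSet_Ioc, integral_const_mul]
  exact mul_le_mul_of_nonneg_left (pker_setIntegral hp hR) h.M_nonneg

/-- Variation bound for mollified `J`. -/
lemma var_bound {r B : ℝ} {ρ J : ℝ → ℝ} (hρ : Mol r ρ) (hr : 0 < r) (hJ : Integrable J) (V : Set ℝ)
    (hB : ∀ φ : ℝ → ℝ, ContDiff ℝ (⊤ : ℕ∞) φ → HasCompactSupport φ → tsupport φ ⊆ V →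
      (∀ x, |φ x| ≤ 1) → ∫ x, deriv φ x * J x ≤ B)
    {U F : Set ℝ} (hU : MeasurableSet U) (hF : IsCompact F) (hFV : F ⊆ V)
    (hUF : ∀ t ∈ U, ∀ y, |t - y| ≤ r → y ∈ F) :
    ∫ t in U, |cv (deriv ρ) J t| ≤ B := by
  set f := cv (deriv ρ) J with hf
  have hfc : Continuous f :=
    hρ.compact.deriv.continuous_convolution_left _ hρ.deriv_cont hJ.locallyIntegrable
  set ψ : ℝ → ℝ := U.indicator (fun t => if 0 ≤ f t then -1 else 1) with hψ
  have hψm : Measurable ψ :=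
    (Measurable.ite (measurableSet_le measurable_const hfc.measurable) measurable_const
      measurable_const).indicator hU
  have hψ1 : ∀ t, |ψ t| ≤ 1 := by
    intro t; rw [hψ]
    by_cases ht : t ∈ U
    · rw [Set.indicator_of_mem ht]; split_ifs <;> simp
    · rw [Set.indicator_of_notMem ht]; simp
  have hUsub : U ⊆ F := fun t ht => hUF t ht t (by simpa using hr.le)
  have hψi : Integrable ψ := by
    rw [hψ, integrable_indicator_iff hU]
    refine Measure.integrableOn_of_bounded (M := 1) ?_ ?_ ?_
    · exact ((measure_mono hUsub).trans_lt hF.measure_lt_top).ne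
    · exact (Measurable.ite (measurableSet_le measurable_const hfc.measurable) measurable_const
        measurable_const).aestronglyMeasurable
    · refine Eventually.of_forall fun t => ?_
      split_ifs <;> simp
  have hder : ∀ y, HasDerivAt (cv ρ ψ) (cv (deriv ρ) ψ y) y := fun y =>
    hρ.compact.hasDerivAt_convolution_left _ hρ.one hψi.locallyIntegrable y
  have hsupp : Function.support (cv ρ ψ) ⊆ F := by
    intro y hy
    by_contra hyF
    refine hy ?_
    rw [cv_swap]
    refine integral_eq_zero_of_ae (Eventually.of_forall fun t => ?_)
    show ρ (y - t) * ψ t = 0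
    by_cases ht : t ∈ U
    · rw [hρ.supp (y - t), zero_mul]
      by_contra hc
      exact hyF (hUF t ht y (by rw [abs_sub_comm]; linarith))
    · rw [hψ, Set.indicator_of_notMem ht, mul_zero]
  have hts : tsupport (cv ρ ψ) ⊆ F := closure_minimal hsupp hF.isClosed
  have key := hB (cv ρ ψ)
    (hρ.compact.contDiff_convolution_left _ hρ.smooth hψi.locallyIntegrable)
    (hF.of_isClosed_subset (isClosed_tsupport _) hts) (hts.trans hFV) (by
      intro x
      have := cv_bound hρ.integrable hψ1 x
      have e : ∫ t, |ρ t| = 1 := by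
        rw [← hρ.int]; congr 1; ext t; exact abs_of_nonneg (hρ.nonneg t)
      rw [e] at this; linarith)
  refine le_trans (le_of_eq ?_) key
  obtain ⟨D, hD⟩ := hρ.compact.deriv.exists_bound_of_continuous hρ.deriv_cont
  have hIntg : Integrable (Function.uncurry fun y t => deriv ρ (y - t) * ψ t * J y)
      (volume.prod volume) := by
    have h1 := hJ.mul_prod hψi
    have h2 := h1.bdd_mul (f := fun z : ℝ × ℝ => deriv ρ (z.1 - z.2)) (c := D)
      (hρ.deriv_cont.comp (continuous_fst.sub continuous_snd)).aestronglyMeasurable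
      (Eventually.of_forall fun z => hD _)
    refine h2.congr (Eventually.of_forall fun z => ?_)
    simp only [Function.uncurry]; ring
  calc ∫ t in U, |f t| = ∫ t, - (ψ t * f t) := by
        rw [← integral_indicator hU]; congr 1; ext t
        by_cases ht : t ∈ U
        · rw [Set.indicator_of_mem ht, hψ, Set.indicator_of_mem ht]
          split_ifs with h0
          · rw [abs_of_nonneg h0]; ring
          · rw [abs_of_neg (not_le.1 h0)]; ring
        · rw [Set.indicator_of_notMem ht, hψ, Set.indicator_of_notMem ht]; simp
    _ = ∫ t, ∫ y, deriv ρ (y - t) * ψ t * J y := by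
        congr 1; ext t
        rw [hf, cv_swap, ← integral_const_mul, ← integral_neg]
        congr 1; ext y
        have := hρ.deriv_odd (y - t)
        rw [neg_sub] at this
        rw [this]; ring
    _ = ∫ y, ∫ t, deriv ρ (y - t) * ψ t * J y := (integral_integral_swap hIntg).symm
    _ = ∫ x, deriv (cv ρ ψ) x * J x := by
        congr 1; ext y
        rw [(hder y).deriv, cv_swap, integral_mul_const]

/-- Reconstruction formula. -/
lemma recon {s B M r : ℝ} {v ρ : ℝ → ℝ} (hs : 0 < s) (hs1 : s < 1)
    (hB : ∀ z, 0 < z → z < 2 → cv (pker (s - 1)) (pker (-s)) z = B) (hv : Good M v)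
    (hρ : Mol r ρ) (hr : r < 1) {x : ℝ} (hx : x < 1) :
    cv (pker (s - 1)) (cv (deriv ρ) (cv (pker (-s)) v)) x = B * cv ρ v x := by
  have hk1 := pker_integrable (p := s - 1) (by linarith)
  have hk2 := pker_integrable (p := -s) (by linarith)
  set g := cv (deriv ρ) v with hg
  have hgi : Integrable g := cv_integrable hρ.deriv_integrable hv.integrable
  have hgb : ∀ x, |g x| ≤ (∫ t, |deriv ρ t|) * M := cv_bound hρ.deriv_integrable hv.bdd
  have e1 : cv (deriv ρ) (cv (pker (-s)) v) = cv (pker (-s)) g := by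
    ext y
    rw [← cv_assoc hρ.deriv_integrable hk2 hv.integrable hv.bdd,
      ← cv_assoc hk2 hρ.deriv_integrable hv.integrable hv.bdd, cv_comm (deriv ρ)]
  rw [e1, ← cv_assoc hk1 hk2 hgi hgb, cv_swap]
  have hder : ∀ y, HasDerivAt (cv ρ v) (g y) y := fun y =>
    hρ.compact.hasDerivAt_convolution_left _ hρ.one hv.integrable.locallyIntegrable y
  have hvc : HasCompactSupport v := by
    refine HasCompactSupport.intro (isCompact_Icc (a := 0) (b := 1)) fun y hy => ?_
    by_cases h0 : 0 ≤ y
    · exact hv.right y (by by_contra hc; exact hy ⟨h0, by linarith⟩)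
    · exact hv.left y (by linarith)
  have hcomp : HasCompactSupport (cv ρ v) := hρ.compact.convolution _ hvc
  have hsm : ContDiff ℝ 1 (cv ρ v) :=
    hρ.compact.contDiff_convolution_left (n := 1) _ (by exact_mod_cast hρ.one)
      hv.integrable.locallyIntegrable
  have hd : deriv (cv ρ v) = g := funext fun t => (hder t).deriv
  have hI := HasCompactSupport.integral_Iic_deriv_eq hsm hcomp x
  rw [hd] at hI
  rw [← hI, integral_Iic_eq_integral_Iio, ← integral_const_mul,
    ← integral_indicator measurableSet_Iio]
  congr 1; ext t
  by_cases ht : t < x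
  · rw [Set.indicator_of_mem (show t ∈ Set.Iio x from ht)]
    by_cases htr : t < -r
    · have : g t = 0 := by
        rw [hg, cv_swap]
        refine integral_eq_zero_of_ae (Eventually.of_forall fun u => ?_)
        show deriv ρ (t - u) * v u = 0
        by_cases hu : u ≤ 0
        · rw [hv.left u hu, mul_zero]
        · rw [hρ.deriv_supp, zero_mul]
          rw [lt_abs]; right; linarith
      rw [this]; simp
    · rw [hB _ (by linarith) (by linarith)]
  · rw [Set.indicator_of_notMem (show t ∉ Set.Iio x from ht)]
    have : cv (pker (s - 1)) (pker (-s)) (x - t) = 0 := by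
      rw [cv_apply]
      refine integral_eq_zero_of_ae (Eventually.of_forall fun u => ?_)
      show pker (s - 1) u * pker (-s) (x - t - u) = 0
      by_cases hu : 0 < u
      · rw [pker_of_nonpos (u := x - t - u) (by linarith), mul_zero]
      · rw [pker_of_nonpos (u := u) (by linarith), zero_mul]
    rw [this, zero_mul]

/-- error term near the left endpoint -/
def eterm (s M D r : ℝ) : ℝ :=
  (3 * r) * ((2 * r) * ((D / r ^ 2) * (M * ((3 * r) ^ (-s + 1) / (-s + 1)))))

lemma eterm_tendsto {s M D : ℝ} (hs1 : s < 1) :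
    Tendsto (fun n : ℕ => eterm s M D ((n : ℝ) + 1)⁻¹) atTop (𝓝 0) := by
  have h0 : Tendsto (fun n : ℕ => 3 * ((n : ℝ) + 1)⁻¹) atTop (𝓝 0) := by
    have : Tendsto (fun n : ℕ => ((n : ℝ) + 1)⁻¹) atTop (𝓝 0) := by
      simpa [one_div] using tendsto_one_div_add_atTop_nhds_zero_nat (𝕜 := ℝ)
    simpa using this.const_mul 3
  have h1 : Tendsto (fun n : ℕ => (3 * ((n : ℝ) + 1)⁻¹) ^ (-s + 1)) atTop (𝓝 0) := by
    have := h0.rpow_const (p := -s + 1) (Or.inr (by linarith))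
    rwa [Real.zero_rpow (by linarith)] at this
  have h2 := h1.const_mul (6 * D * M / (-s + 1))
  rw [mul_zero] at h2
  refine h2.congr fun n => ?_
  unfold eterm
  have : (n : ℝ) + 1 ≠ 0 := by positivity
  have : -s + 1 ≠ 0 := by linarith
  field_simp
  ring

lemma left_bound {s M D r : ℝ} {v ρ : ℝ → ℝ} (hs1 : s < 1) (hv : Good M v) (hr : 0 < r)
    (hD : 0 < D) (hρ : Mol r ρ) (hρD : ∀ x, |deriv ρ x| ≤ D / r ^ 2) :
    ∫ t in Set.Iio (2 * r), |cv (deriv ρ) (cv (pker (-s)) v) t| ≤ eterm s M D r := by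
  set J := cv (pker (-s)) v with hJ
  set K := (D / r ^ 2) * (M * ((3 * r) ^ (-s + 1) / (-s + 1))) with hK
  have hM := hv.M_nonneg
  have hs' : 0 < -s + 1 := by linarith
  have hK0 : 0 ≤ K := by positivity
  have hpt : ∀ t < 2 * r, |cv (deriv ρ) J t| ≤ (2 * r) * K := by
    intro t ht
    rw [cv_swap, ← Real.norm_eq_abs]
    have : ∫ y, (Set.Icc (t - r) (t + r)).indicator (fun _ => K) y = (2 * r) * K := by
      rw [integral_indicator measurableSet_Icc, setIntegral_const, smul_eq_mul, Real.volume_real_Icc_of_le (by linarith)]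
      ring
    rw [← this]
    refine norm_integral_le_of_norm_le ?_ (Eventually.of_forall fun y => ?_)
    · exact (integrable_indicator_iff measurableSet_Icc).2 (by simp)
    · by_cases hy : y ∈ Set.Icc (t - r) (t + r)
      · rw [Set.indicator_of_mem hy, norm_mul]
        exact mul_le_mul (hρD _) (J_bound hv (by linarith) (by linarith) (by linarith [hy.2]))
          (norm_nonneg _) (by positivity)
      · rw [Set.indicator_of_notMem hy, hρ.deriv_supp, zero_mul, norm_zero]
        by_contra hc
        rw [not_lt, abs_le] at hc
        exact hy ⟨by linarith [hc.2], by linarith [hc.1]⟩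
  have hz : ∀ t < -r, cv (deriv ρ) J t = 0 := by
    intro t ht
    rw [cv_swap]
    refine integral_eq_zero_of_ae (Eventually.of_forall fun y => ?_)
    show deriv ρ (t - y) * J y = 0
    by_cases hy : y ≤ 0
    · rw [hJ, J_zero hv hy, mul_zero]
    · rw [hρ.deriv_supp, zero_mul]
      rw [lt_abs]; right; linarith
  have h1 : ∫ t in Set.Iio (2 * r), |cv (deriv ρ) J t|
      ≤ ∫ t, (Set.Icc (-r) (2 * r)).indicator (fun _ => (2 * r) * K) t := by
    rw [← integral_indicator measurableSet_Iio]
    have hfi : Integrable (cv (deriv ρ) J) := cv_integrable hρ.deriv_integrable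
      (cv_integrable (pker_integrable (by linarith)) hv.integrable)
    refine integral_mono (hfi.abs.indicator measurableSet_Iio)
      ((integrable_indicator_iff measurableSet_Icc).2 (integrableOn_const (by simp))) fun t => ?_
    by_cases ht : t < 2 * r
    · rw [Set.indicator_of_mem (show t ∈ Set.Iio (2 * r) from ht)]
      by_cases ht2 : t < -r
      · rw [hz t ht2, abs_zero]
        exact Set.indicator_nonneg (fun _ _ => by positivity) _
      · rw [Set.indicator_of_mem (show t ∈ Set.Icc (-r) (2 * r) from ⟨not_lt.1 ht2, ht.le⟩)]
        exact hpt t ht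
    · rw [Set.indicator_of_notMem (show t ∉ Set.Iio (2 * r) from ht)]
      exact Set.indicator_nonneg (fun _ _ => by positivity) _
  refine h1.trans (le_of_eq ?_)
  rw [integral_indicator measurableSet_Icc, setIntegral_const, smul_eq_mul, Real.volume_real_Icc_of_le (by linarith)]
  unfold eterm
  rw [hK]; ring

/-- The hypothesis that the variation functional of `J` is bounded by `B` on `V`. -/
def VarLe (J : ℝ → ℝ) (V : Set ℝ) (B : ℝ) : Prop :=
  ∀ φ : ℝ → ℝ, ContDiff ℝ (⊤ : ℕ∞) φ → HasCompactSupport φ → tsupport φ ⊆ V →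
      (∀ x, |φ x| ≤ 1) → ∫ x, deriv φ x * J x ≤ B

lemma setInt_union_le {f : ℝ → ℝ} (hf : Integrable f) (h0 : ∀ x, 0 ≤ f x) {S A U : Set ℝ}
    (hS : MeasurableSet S) (hA : MeasurableSet A)
    (hU : MeasurableSet U) (h : S ⊆ A ∪ U) :
    ∫ x in S, f x ≤ (∫ x in A, f x) + ∫ x in U, f x := by
  rw [← integral_indicator hS, ← integral_indicator hA, ← integral_indicator hU,
    ← integral_add (hf.indicator hA) (hf.indicator hU)]
  refine integral_mono (hf.indicator hS) ((hf.indicator hA).add (hf.indicator hU)) fun x => ?_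
  have hA0 : 0 ≤ A.indicator f x := Set.indicator_nonneg (fun x _ => h0 x) x
  have hU0 : 0 ≤ U.indicator f x := Set.indicator_nonneg (fun x _ => h0 x) x
  show _ ≤ A.indicator f x + U.indicator f x
  by_cases hx : x ∈ S
  · rw [Set.indicator_of_mem hx]
    rcases h hx with hx' | hx'
    · rw [Set.indicator_of_mem hx']; linarith
    · rw [Set.indicator_of_mem hx' (f := f)]; linarith
  · rw [Set.indicator_of_notMem hx]; linarith

lemma est {s M D r B T ε a b C h : ℝ} {v ρ : ℝ → ℝ} (hs : 0 < s) (hs1 : s < 1) (hB0 : 0 < B)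
    (hB : ∀ z, 0 < z → z < 2 → cv (pker (s - 1)) (pker (-s)) z = B) (hv : Good M v)
    (hT : VarLe (cv (pker (-s)) v) (Set.Ioo 0 1) T)
    (hε : VarLe (cv (pker (-s)) v) (Set.Ioo 0 a ∪ Set.Ioo b 1) ε)
    (ha : 0 < a) (hab : a ≤ b) (hb : b < 1) (hC0 : 0 ≤ C)
    (hC : ∀ z, (1 - b) / 3 ≤ z → z + h < 2 → |pker (s - 1) (z + h) - pker (s - 1) z| ≤ C * h)
    (hh : 0 < h) (hha : h < a / 4) (hhb : h < (1 - b) / 6)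
    (hr : 0 < r) (hrh : 2 * r ≤ h) (hra : r < a / 4) (hrb : r < (1 - b) / 3)
    (hD : 0 < D) (hρ : Mol r ρ) (hρD : ∀ x, |deriv ρ x| ≤ D / r ^ 2) :
    B * ∫ x in Set.Ioo 0 (a / 2) ∪ Set.Ioo ((b + 2) / 3) (1 - 2 * h), |cv ρ v (x + h) - cv ρ v x|
      ≤ (eterm s M D r + ε) * (2 * (h ^ s / s)) + C * h * (eterm s M D r + T) := by
  set J := cv (pker (-s)) v with hJ
  set f := cv (deriv ρ) J with hf
  have hJi : Integrable J := cv_integrable (pker_integrable (by linarith)) hv.integrable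
  have hfi : Integrable f := cv_integrable hρ.deriv_integrable hJi
  have hfa : ∀ x, 0 ≤ |f x| := fun x => abs_nonneg _
  have hL := left_bound hs1 hv hr hD hρ hρD
  set S : Set ℝ := Set.Iio (3 * a / 4) ∪ Set.Ico ((2 * b + 1) / 3) (1 - h) with hS
  have hSm : MeasurableSet S := measurableSet_Iio.union measurableSet_Ico
  have hS1 : ∫ t in S, |f t| ≤ eterm s M D r + ε := by
    have hV : ∫ t in Set.Ico (2 * r) (3 * a / 4) ∪ Set.Ico ((2 * b + 1) / 3) (1 - 2 * r), |f t| ≤ ε := by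
      refine var_bound hρ hr hJi _ hε (measurableSet_Ico.union measurableSet_Ico)
        (F := Set.Icc r (3 * a / 4 + r) ∪ Set.Icc ((2 * b + 1) / 3 - r) (1 - r))
        (isCompact_Icc.union isCompact_Icc) ?_ ?_
      · refine Set.union_subset_union ?_ ?_
        · intro y hy; exact ⟨by linarith [hy.1], by linarith [hy.2]⟩
        · intro y hy; exact ⟨by linarith [hy.1], by linarith [hy.2]⟩
      · intro t ht y hty
        rw [abs_le] at hty
        rcases ht with ht | ht
        · left; exact ⟨by linarith [ht.1], by linarith [ht.2]⟩
        · right; exact ⟨by linarith [ht.1], by linarith [ht.2]⟩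
    refine (setInt_union_le hfi.abs hfa hSm measurableSet_Iio
      (measurableSet_Ico.union measurableSet_Ico) ?_).trans (add_le_add hL hV)
    intro t ht
    by_cases h2 : t < 2 * r
    · left; exact h2
    · right
      rcases ht with ht | ht
      · left; exact ⟨not_lt.1 h2, ht⟩
      · right; exact ⟨ht.1, by linarith [ht.2]⟩
  have hS2 : ∫ t in Set.Iio (1 - h), |f t| ≤ eterm s M D r + T := by
    have hV : ∫ t in Set.Ico (2 * r) (1 - 2 * r), |f t| ≤ T := by
      refine var_bound hρ hr hJi _ hT measurableSet_Ico
        (F := Set.Icc r (1 - r)) isCompact_Icc ?_ ?_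
      · intro y hy; exact ⟨by linarith [hy.1], by linarith [hy.2]⟩
      · intro t ht y hty
        rw [abs_le] at hty
        exact ⟨by linarith [ht.1], by linarith [ht.2]⟩
    refine (setInt_union_le hfi.abs hfa measurableSet_Iio measurableSet_Iio
      measurableSet_Ico ?_).trans (add_le_add hL hV)
    intro t ht
    by_cases h2 : t < 2 * r
    · left; exact h2
    · right; exact ⟨not_lt.1 h2, by have : t < 1 - h := ht; linarith⟩
  set k := pker (s - 1) with hk
  have hki : Integrable k := pker_integrable (by linarith)
  set Dh : ℝ → ℝ := fun z => |k (z + h) - k z| with hDh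
  have hDi : Integrable Dh := ((hki.comp_add_right h).sub hki).abs
  set F : ℝ → ℝ := S.indicator (fun t => |f t|) with hF
  have hFi : Integrable F := hfi.abs.indicator hSm
  have hF0 : ∀ t, 0 ≤ F t := fun t => Set.indicator_nonneg (fun x _ => abs_nonneg _) t
  have hfc : Continuous f :=
    hρ.compact.deriv.continuous_convolution_left _ hρ.deriv_cont hJi.locallyIntegrable
  obtain ⟨Mf, hMf⟩ : ∃ Mf, ∀ x, |f x| ≤ Mf :=
    ⟨_, cv_bound hρ.deriv_integrable fun x => (cv_bound (pker_integrable (by linarith)) hv.bdd x)⟩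
  have hFb : ∀ x, |F x| ≤ Mf := fun x => by
    by_cases hx : x ∈ S
    · rw [hF, Set.indicator_of_mem hx, abs_abs]; exact hMf x
    · rw [hF, Set.indicator_of_notMem hx, abs_zero]; exact (abs_nonneg _).trans (hMf 0)
  -- pointwise bound
  set A : Set ℝ := Set.Ioo 0 (a / 2) ∪ Set.Ioo ((b + 2) / 3) (1 - 2 * h) with hA
  have hAm : MeasurableSet A := measurableSet_Ioo.union measurableSet_Ioo
  have hpt : ∀ x ∈ A, B * |cv ρ v (x + h) - cv ρ v x|
      ≤ cv F Dh x + C * h * ∫ t in Set.Iio (1 - h), |f t| := by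
    intro x hx
    have hx1 : x + h < 1 - h := by
      rcases hx with hx | hx
      · linarith [hx.2]
      · linarith [hx.2]
    have r1 := recon hs hs1 hB hv hρ (by linarith) (x := x + h) (by linarith)
    have r2 := recon hs hs1 hB hv hρ (by linarith) (x := x) (by linarith)
    have i1 : Integrable fun t => k (x + h - t) * f t := by
      have := (cv_integrand_int hki hfc.aestronglyMeasurable hMf (x + h)).comp_sub_left (x + h)
      simpa using this
    have i2 : Integrable fun t => k (x - t) * f t := by
      have := (cv_integrand_int hki hfc.aestronglyMeasurable hMf x).comp_sub_left x
      simpa using this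
    have i3 : Integrable fun t => F t * Dh (x - t) := by
      have := (cv_integrand_int hDi hFi.1 hFb x).comp_sub_left x
      simpa [mul_comm] using this
    have e1 : B * (cv ρ v (x + h) - cv ρ v x)
        = ∫ t, (k (x + h - t) * f t - k (x - t) * f t) := by
      rw [integral_sub i1 i2, ← cv_swap, ← cv_swap, mul_sub, ← r1, ← r2]
    have eB : B * |cv ρ v (x + h) - cv ρ v x| = |B * (cv ρ v (x + h) - cv ρ v x)| := by
      rw [abs_mul, abs_of_pos hB0]
    rw [eB, e1, cv_apply,
      ← integral_const_mul, ← integral_indicator measurableSet_Iio,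
      ← integral_add i3 ((hfi.abs.const_mul _).indicator measurableSet_Iio), ← Real.norm_eq_abs]
    refine norm_integral_le_of_norm_le
      (i3.add ((hfi.abs.const_mul _).indicator measurableSet_Iio)) (Eventually.of_forall fun t => ?_)
    have en : ‖k (x + h - t) * f t - k (x - t) * f t‖ = |f t| * Dh (x - t) := by
      rw [← sub_mul, norm_mul, mul_comm, hDh]
      simp only [Real.norm_eq_abs]
      rw [show x + h - t = x - t + h by ring]
    rw [en]
    have hI0 : 0 ≤ (Set.Iio (1 - h)).indicator (fun t => C * h * |f t|) t :=
      Set.indicator_nonneg (fun _ _ => by positivity) _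
    show _ ≤ F t * Dh (x - t) + (Set.Iio (1 - h)).indicator (fun t => C * h * |f t|) t
    by_cases htS : t ∈ S
    · rw [hF, Set.indicator_of_mem htS]; linarith
    · have hFt : F t = 0 := by rw [hF, Set.indicator_of_notMem htS]
      rw [hFt, zero_mul, zero_add]
      by_cases hxt : x + h ≤ t
      · have : Dh (x - t) = 0 := by
          rw [hDh]; simp only
          rw [hk, pker_of_nonpos (by linarith), pker_of_nonpos (by linarith)]; simp
        rw [this, mul_zero]; exact hI0
      · rw [not_le] at hxt
        have t1 : 3 * a / 4 ≤ t := by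
          by_contra hc; exact htS (Or.inl (not_le.1 hc))
        have t2 : t < (2 * b + 1) / 3 := by
          by_contra hc; exact htS (Or.inr ⟨not_lt.1 hc, by linarith⟩)
        rw [Set.indicator_of_mem (show t ∈ Set.Iio (1 - h) by
          show t < 1 - h
          linarith)]
        rcases hx with hx | hx
        · linarith [hx.2]
        · have := hC (x - t) (by linarith [hx.1]) (by linarith)
          rw [mul_comm (|f t|)]
          exact mul_le_mul_of_nonneg_right this (abs_nonneg _)
  have hcvi : Integrable (cv F Dh) := cv_integrable hFi hDi
  have hcv0 : ∀ x, 0 ≤ cv F Dh x := fun x => by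
    rw [cv_apply]; exact integral_nonneg fun t => mul_nonneg (hF0 t) (abs_nonneg _)
  have hAfin : volume A ≠ ⊤ :=
    ((measure_union_lt_top (by simp) (by simp))).ne
  have hAle : volume.real A ≤ 1 := by
    have : A ⊆ Set.Ioo 0 1 := by
      intro x hx
      rcases hx with hx | hx
      · exact ⟨hx.1, by linarith [hx.2]⟩
      · exact ⟨by linarith [hx.1], by linarith [hx.2]⟩
    have h2 := measureReal_mono (μ := volume) this (by simp)
    rw [Real.volume_real_Ioo_of_le (by norm_num)] at h2
    linarith
  set I2 := ∫ t in Set.Iio (1 - h), |f t| with hI2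
  have hI20 : 0 ≤ I2 := integral_nonneg fun t => abs_nonneg _
  have hui : Integrable (cv ρ v) := cv_integrable hρ.integrable hv.integrable
  rw [← integral_const_mul]
  calc ∫ x in A, B * |cv ρ v (x + h) - cv ρ v x|
      ≤ ∫ x in A, (cv F Dh x + C * h * I2) := by
        refine setIntegral_mono_on ?_ ?_ hAm hpt
        · exact (((hui.comp_add_right h).sub hui).abs.const_mul B).integrableOn
        · exact hcvi.integrableOn.add (integrableOn_const hAfin)
    _ = (∫ x in A, cv F Dh x) + volume.real A * (C * h * I2) := by
        rw [integral_add hcvi.integrableOn (integrableOn_const hAfin), setIntegral_const, smul_eq_mul]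
    _ ≤ (∫ x, cv F Dh x) + 1 * (C * h * I2) := by
        refine add_le_add (setIntegral_le_integral hcvi (Eventually.of_forall hcv0)) ?_
        exact mul_le_mul_of_nonneg_right hAle (by positivity)
    _ ≤ _ := by
        rw [integral_cv hFi hDi, one_mul]
        have hF1 : ∫ t, F t ≤ eterm s M D r + ε := by
          rw [hF, integral_indicator hSm]; exact hS1
        have hD1 : ∫ z, Dh z ≤ 2 * (h ^ s / s) := by
          have := pker_translate (p := s - 1) (by linarith) (by linarith) hh
          rwa [sub_add_cancel] at this
        have hF00 : 0 ≤ ∫ t, F t := integral_nonneg hF0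
        have hD0 : 0 ≤ ∫ z, Dh z := integral_nonneg fun _ => abs_nonneg _
        refine add_le_add (mul_le_mul hF1 hD1 hD0 (hF00.trans hF1)) ?_
        exact mul_le_mul_of_nonneg_left hS2 (by positivity)

lemma mol_close {r M η x : ℝ} {ρ v : ℝ → ℝ} (hρ : Mol r ρ) (hv : Good M v)
    (h : ∀ t, |t| < r → |v (x - t) - v x| ≤ η) : |cv ρ v x - v x| ≤ η := by
  have e1 : v x = ∫ t, ρ t * v x := by rw [integral_mul_const, hρ.int, one_mul]
  have i1 := cv_integrand_int hρ.integrable hv.meas.aestronglyMeasurable hv.bdd x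
  have e2 : cv ρ v x - v x = ∫ t, (ρ t * v (x - t) - ρ t * v x) := by
    rw [integral_sub i1 (hρ.integrable.mul_const _), ← e1, cv_apply]
  have e3 : η = ∫ t, ρ t * η := by rw [integral_mul_const, hρ.int, one_mul]
  rw [e2, e3, ← Real.norm_eq_abs]
  refine norm_integral_le_of_norm_le (hρ.integrable.mul_const _) (Eventually.of_forall fun t => ?_)
  rw [← mul_sub, norm_mul, Real.norm_of_nonneg (hρ.nonneg t)]
  by_cases ht : |t| < r
  · exact mul_le_mul_of_nonneg_left (h t ht) (hρ.nonneg t)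
  · rw [hρ.supp t (not_lt.1 ht)]; simp

lemma est_lim {s M B T ε a b C h : ℝ} {v : ℝ → ℝ} (hs : 0 < s) (hs1 : s < 1) (hB0 : 0 < B)
    (hB : ∀ z, 0 < z → z < 2 → cv (pker (s - 1)) (pker (-s)) z = B) (hv : Good M v)
    (hcont : ∀ x ∈ Set.Ioo (0:ℝ) 1, ContinuousAt v x)
    (hT : VarLe (cv (pker (-s)) v) (Set.Ioo 0 1) T)
    (hε : VarLe (cv (pker (-s)) v) (Set.Ioo 0 a ∪ Set.Ioo b 1) ε)
    (ha : 0 < a) (hab : a ≤ b) (hb : b < 1) (hC0 : 0 ≤ C)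
    (hC : ∀ z, (1 - b) / 3 ≤ z → z + h < 2 → |pker (s - 1) (z + h) - pker (s - 1) z| ≤ C * h)
    (hh : 0 < h) (hha : h < a / 4) (hhb : h < (1 - b) / 6) :
    B * ∫ x in Set.Ioo 0 (a / 2) ∪ Set.Ioo ((b + 2) / 3) (1 - 2 * h), |v (x + h) - v x|
      ≤ ε * (2 * (h ^ s / s)) + C * h * T := by
  obtain ⟨D, hD, hmol⟩ := exists_mol
  have hrpos : ∀ n : ℕ, 0 < ((n : ℝ) + 1)⁻¹ := fun n => by positivity
  choose ρ hρ hρD using fun n : ℕ => hmol _ (hrpos n)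
  have hr0 : Tendsto (fun n : ℕ => ((n : ℝ) + 1)⁻¹) atTop (𝓝 0) := by
    simpa [one_div] using tendsto_one_div_add_atTop_nhds_zero_nat (𝕜 := ℝ)
  have hpt : ∀ x ∈ Set.Ioo (0:ℝ) 1, Tendsto (fun n => cv (ρ n) v x) atTop (𝓝 (v x)) := by
    intro x hx
    rw [Metric.tendsto_atTop']
    intro η hη
    obtain ⟨d, hd, hd2⟩ := Metric.continuousAt_iff.1 (hcont x hx) (η / 2) (by linarith)
    obtain ⟨N, hN⟩ := eventually_atTop.1 (hr0.eventually_lt_const hd)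
    refine ⟨N, fun n hn => ?_⟩
    rw [Real.dist_eq]
    refine (mol_close (hρ n) hv (η := η / 2) fun t ht => ?_).trans_lt (by linarith)
    have := hd2 (x := x - t) (by
      rw [Real.dist_eq]; simp only [sub_sub_cancel_left, abs_neg]
      exact ht.trans (hN n hn.le))
    rw [Real.dist_eq] at this
    exact this.le
  have hAsub : ∀ x ∈ Set.Ioo 0 (a / 2) ∪ Set.Ioo ((b + 2) / 3) (1 - 2 * h), 0 < x ∧ x + h < 1 := by
    intro x hx
    rcases hx with hx | hx
    · exact ⟨hx.1, by linarith [hx.2]⟩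
    · exact ⟨by linarith [hx.1], by linarith [hx.2]⟩
  have hAm : MeasurableSet (Set.Ioo 0 (a / 2) ∪ Set.Ioo ((b + 2) / 3) (1 - 2 * h)) :=
    measurableSet_Ioo.union measurableSet_Ioo
  have hAfin : volume (Set.Ioo 0 (a / 2) ∪ Set.Ioo ((b + 2) / 3) (1 - 2 * h)) ≠ ⊤ :=
    ((measure_union_lt_top (by simp) (by simp))).ne
  have hub : ∀ n x, |cv (ρ n) v x| ≤ M := fun n x => by
    have := cv_bound (hρ n).integrable hv.bdd x
    have e : ∫ t, |ρ n t| = 1 := by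
      rw [← (hρ n).int]; congr 1; ext t; exact abs_of_nonneg ((hρ n).nonneg t)
    rwa [e, one_mul] at this
  have hui : ∀ n, Integrable (cv (ρ n) v) := fun n => cv_integrable (hρ n).integrable hv.integrable
  have lim1 : Tendsto (fun n => ∫ x in Set.Ioo 0 (a / 2) ∪ Set.Ioo ((b + 2) / 3) (1 - 2 * h),
      |cv (ρ n) v (x + h) - cv (ρ n) v x|) atTop
      (𝓝 (∫ x in Set.Ioo 0 (a / 2) ∪ Set.Ioo ((b + 2) / 3) (1 - 2 * h), |v (x + h) - v x|)) := by
    refine tendsto_integral_of_dominated_convergence (fun _ => 2 * M) ?_ (integrableOn_const hAfin) ?_ ?_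
    · intro n
      exact (((hui n).comp_add_right h).sub (hui n)).abs.1.restrict
    · intro n
      refine Eventually.of_forall fun x => ?_
      rw [Real.norm_eq_abs, abs_abs]
      have := abs_sub (cv (ρ n) v (x + h)) (cv (ρ n) v x)
      linarith [hub n x, hub n (x + h)]
    · refine (ae_restrict_iff' hAm).2 (Eventually.of_forall fun x hx => ?_)
      obtain ⟨p, q⟩ := hAsub x hx
      exact ((hpt (x + h) ⟨by linarith, q⟩).sub (hpt x ⟨p, by linarith⟩)).abs
  have het := eterm_tendsto (s := s) (M := M) (D := D) hs1
  have lim2 := ((het.add_const ε).mul_const (2 * (h ^ s / s))).add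
    ((het.add_const T).const_mul (C * h))
  rw [zero_add, zero_add] at lim2
  refine le_of_tendsto_of_tendsto (lim1.const_mul B) lim2 ?_
  filter_upwards [hr0.eventually_lt_const (show 0 < h / 2 by linarith)] with n hn
  exact est hs hs1 hB0 hB hv hT hε ha hab hb hC0 hC hh hha hhb (hrpos n) (by linarith)
    (by linarith) (by linarith) hD (hρ n) (hρD n)

lemma dR1_eq {s : ℝ} (hs : 0 < s) (hs1 : s < 1) {φ : ℝ → ℝ} (hφ : ContDiff ℝ (⊤ : ℕ∞) φ)
    (hc : HasCompactSupport φ) (hsup : tsupport φ ⊆ Set.Ioo 0 1) {y : ℝ} (hy : y ∈ Set.Ioo (0:ℝ) 1) :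
    dR1 s φ y = -(1 / Real.Gamma (1 - s)) * ∫ t, pker (-s) (t - y) * deriv φ t := by
  have hfl : Nat.floor s = 0 := Nat.floor_eq_zero.2 hs1
  unfold dR1
  rw [hfl]
  simp only [Nat.cast_zero, sub_zero, zero_add, pow_one, iteratedDeriv_one]
  set kr : ℝ → ℝ := fun u => pker (-s) (-u) with hkr
  have hki : Integrable kr := (pker_integrable (by linarith)).comp_neg
  have h1 : ContDiff ℝ 1 φ := hφ.of_le (by exact_mod_cast le_top)
  have hd : HasDerivAt (cv kr φ) (cv kr (deriv φ) y) y :=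
    hc.hasDerivAt_convolution_right _ hki.locallyIntegrable h1 y
  have heq : (fun y => ∫ t in Set.Ioo y 1, φ t * (t - y) ^ (-s)) =ᶠ[𝓝 y] cv kr φ := by
    filter_upwards [isOpen_Ioo.mem_nhds hy] with z hz
    rw [cv_swap, ← integral_indicator measurableSet_Ioo]
    congr 1; ext t
    simp only [hkr, neg_sub]
    by_cases ht : t ∈ Set.Ioo z 1
    · rw [Set.indicator_of_mem ht, pker_of_mem (by linarith [ht.1]) (by linarith [ht.2, hz.1]), mul_comm]
    · rw [Set.indicator_of_notMem ht]
      by_cases htz : t ≤ z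
      · rw [pker_of_nonpos (by linarith), zero_mul]
      · have : φ t = 0 := by
          apply image_eq_zero_of_notMem_tsupport
          intro h; exact ht ⟨not_le.1 htz, (hsup h).2⟩
        rw [this, mul_zero]
  rw [heq.deriv_eq, hd.deriv, cv_swap]
  simp only [hkr, neg_sub]
  ring

lemma dR_formula {s M : ℝ} (hs : 0 < s) (hs1 : s < 1) {w φ : ℝ → ℝ}
    (hv : Good M ((Set.Ioo (0:ℝ) 1).indicator w)) (hφ : ContDiff ℝ (⊤ : ℕ∞) φ)
    (hc : HasCompactSupport φ) (hsup : tsupport φ ⊆ Set.Ioo 0 1) :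
    ∫ x in Set.Ioo (0:ℝ) 1, w x * dR1 s φ x = -(1 / Real.Gamma (1 - s)) *
      ∫ t, deriv φ t * cv (pker (-s)) ((Set.Ioo (0:ℝ) 1).indicator w) t := by
  set v := (Set.Ioo (0:ℝ) 1).indicator w with hvdef
  have h1 : ContDiff ℝ 1 φ := hφ.of_le (by exact_mod_cast le_top)
  have hdc : Continuous (deriv φ) := h1.continuous_deriv le_rfl
  obtain ⟨D, hD⟩ := hc.deriv.exists_bound_of_continuous hdc
  have hk : Integrable (pker (-s)) := pker_integrable (by linarith)
  have e1 : ∫ x in Set.Ioo (0:ℝ) 1, w x * dR1 s φ x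
      = ∫ y, -(1 / Real.Gamma (1 - s)) * ∫ t, deriv φ t * (v y * pker (-s) (t - y)) := by
    rw [← integral_indicator measurableSet_Ioo]
    congr 1; ext y
    have e : ∫ t, deriv φ t * (v y * pker (-s) (t - y)) = v y * ∫ t, pker (-s) (t - y) * deriv φ t := by
      rw [← integral_const_mul]; congr 1; ext t; ring
    rw [e]
    by_cases hy : y ∈ Set.Ioo (0:ℝ) 1
    · rw [Set.indicator_of_mem hy, dR1_eq hs hs1 hφ hc hsup hy, hvdef, Set.indicator_of_mem hy]
      ring
    · rw [Set.indicator_of_notMem hy, hvdef, Set.indicator_of_notMem hy]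
      ring
  rw [e1, integral_const_mul]
  congr 1
  have hIntg : Integrable (fun p : ℝ × ℝ => deriv φ p.1 * (v p.2 * pker (-s) (p.1 - p.2)))
      (volume.prod volume) := by
    have := hv.integrable.convolution_integrand (ContinuousLinearMap.mul ℝ ℝ) hk (μ := volume) (ν := volume)
    refine Integrable.bdd_mul (c := D) this ?_ ?_
    · exact (hdc.comp continuous_fst).aestronglyMeasurable
    · exact Eventually.of_forall fun p => hD _
  rw [← integral_integral_swap (f := fun t y => deriv φ t * (v y * pker (-s) (t - y))) hIntg]
  congr 1; ext t
  rw [integral_const_mul, cv_swap]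
  congr 2; ext y; ring

lemma varLe_of_TV {s M : ℝ} (hs : 0 < s) (hs1 : s < 1) {w : ℝ → ℝ}
    (hv : Good M ((Set.Ioo (0:ℝ) 1).indicator w)) (hTV : TV1 s w < ⊤) :
    VarLe (cv (pker (-s)) ((Set.Ioo (0:ℝ) 1).indicator w)) (Set.Ioo 0 1)
      (Real.Gamma (1 - s) * (TV1 s w).toReal) := by
  intro φ hφ hc hsup hb
  have hG : 0 < Real.Gamma (1 - s) := Real.Gamma_pos_of_pos (by linarith)
  have hsup' : tsupport (-φ) ⊆ Set.Ioo 0 1 := by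
    rw [tsupport, Function.support_neg]; exact hsup
  have hle : ENNReal.ofReal (∫ x in Set.Ioo (0:ℝ) 1, w x * dR1 s (-φ) x) ≤ TV1 s w := by
    unfold TV1
    exact le_iSup (fun φ : {φ : ℝ → ℝ // ContDiff ℝ (⊤ : ℕ∞) φ ∧ HasCompactSupport φ ∧
      tsupport φ ⊆ Set.Ioo 0 1 ∧ ∀ x, |φ x| ≤ 1} =>
      ENNReal.ofReal (∫ x in Set.Ioo (0:ℝ) 1, w x * dR1 s φ.1 x))
      ⟨-φ, hφ.neg, hc.neg, hsup', fun x => by simpa using hb x⟩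
  rw [ENNReal.ofReal_le_iff_le_toReal hTV.ne, dR_formula (φ := -φ) hs hs1 hv hφ.neg hc.neg hsup'] at hle
  have e : ∫ t, deriv (-φ) t * cv (pker (-s)) ((Set.Ioo (0:ℝ) 1).indicator w) t
      = - ∫ t, deriv φ t * cv (pker (-s)) ((Set.Ioo (0:ℝ) 1).indicator w) t := by
    rw [← integral_neg]; congr 1; ext t
    rw [deriv.neg]; ring
  rw [e, neg_mul_neg, one_div, inv_mul_le_iff₀ hG] at hle
  exact hle

lemma VarLe.mono {J : ℝ → ℝ} {V V' : Set ℝ} {B : ℝ} (h : VarLe J V B) (hV : V' ⊆ V) : VarLe J V' B :=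
  fun φ a b c d => h φ a b (c.trans hV) d

lemma varLe_local {s M : ℝ} (hs : 0 < s) (hs1 : s < 1) {w : ℝ → ℝ}
    (hv : Good M ((Set.Ioo (0:ℝ) 1).indicator w)) (hTV : TV1 s w < ⊤) {ε : ℝ}
    (hε : 0 < ε) (hpos : 0 < (TV1 s w).toReal) :
    ∃ a b : ℝ, 0 < a ∧ a ≤ b ∧ b < 1 ∧
    VarLe (cv (pker (-s)) ((Set.Ioo (0:ℝ) 1).indicator w)) (Set.Ioo 0 a ∪ Set.Ioo b 1)
      (Real.Gamma (1 - s) * ε) := by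
  have hVT := varLe_of_TV hs hs1 hv hTV
  have hG : 0 < Real.Gamma (1 - s) := Real.Gamma_pos_of_pos (by linarith)
  set J := cv (pker (-s)) ((Set.Ioo (0:ℝ) 1).indicator w) with hJ
  have hJi : Integrable J := cv_integrable (pker_integrable (by linarith)) hv.integrable
  set T := (TV1 s w).toReal with hT
  have hlt : ENNReal.ofReal (T - ε) < TV1 s w := by
    by_cases h : 0 ≤ T - ε
    · rw [ENNReal.ofReal_lt_iff_lt_toReal h hTV.ne]; linarith
    · rw [ENNReal.ofReal_of_nonpos (by linarith)]
      exact (ENNReal.toReal_pos_iff.1 hpos).1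
  unfold TV1 at hlt
  rw [lt_iSup_iff] at hlt
  obtain ⟨⟨φ0, g1, g2, g3, g4⟩, hlt⟩ := hlt
  have hlt := (ENNReal.ofReal_lt_ofReal_iff').1 hlt |>.1
  simp only at hlt
  rw [dR_formula hs hs1 hv g1 g2 g3] at hlt
  obtain ⟨a, b, ha, hab, hb, hsub⟩ : ∃ a b : ℝ, 0 < a ∧ a ≤ b ∧ b < 1 ∧ tsupport φ0 ⊆ Set.Icc a b := by
    by_cases hne : (tsupport φ0).Nonempty
    · obtain ⟨a, ha⟩ := g2.isCompact.exists_isLeast hne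
      obtain ⟨b, hb⟩ := g2.isCompact.exists_isGreatest hne
      exact ⟨a, b, (g3 ha.1).1, ha.2 hb.1, (g3 hb.1).2, fun x hx => ⟨ha.2 hx, hb.2 hx⟩⟩
    · rw [Set.not_nonempty_iff_eq_empty] at hne
      exact ⟨1/4, 3/4, by norm_num, by norm_num, by norm_num, by rw [hne]; exact Set.empty_subset _⟩
  refine ⟨a, b, ha, hab, hb, fun φ h1 h2 h3 h4 => ?_⟩
  have hz : ∀ x, φ0 x = 0 ∨ φ x = 0 := by
    intro x
    by_cases h : x ∈ tsupport φ0
    · right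
      apply image_eq_zero_of_notMem_tsupport
      intro hx
      rcases h3 hx with hx | hx
      · linarith [hx.2, (hsub h).1]
      · linarith [hx.1, (hsub h).2]
    · left; exact image_eq_zero_of_notMem_tsupport h
  have h3' : tsupport φ ⊆ Set.Ioo 0 1 := by
    refine h3.trans (Set.union_subset ?_ ?_)
    · exact Set.Ioo_subset_Ioo_right (by linarith)
    · exact Set.Ioo_subset_Ioo_left (by linarith)
  have key := hVT (φ - φ0) (h1.sub g1) (h2.sub g2)
    ((tsupport_sub _ _).trans (Set.union_subset h3' g3)) (fun x => by
      rcases hz x with h | h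
      · simpa [h] using h4 x
      · simpa [h] using g4 x)
  have dd : ∀ ψ : ℝ → ℝ, ContDiff ℝ (⊤ : ℕ∞) ψ → HasCompactSupport ψ → Integrable fun x => deriv ψ x * J x := by
    intro ψ hψ hψc
    have hψ1 : ContDiff ℝ 1 ψ := hψ.of_le (by exact_mod_cast le_top)
    obtain ⟨D, hD⟩ := hψc.deriv.exists_bound_of_continuous (hψ1.continuous_deriv le_rfl)
    exact hJi.bdd_mul (c := D) (hψ1.continuous_deriv le_rfl).aestronglyMeasurable (Eventually.of_forall hD)
  have e : ∫ x, deriv (φ - φ0) x * J x = (∫ x, deriv φ x * J x) - ∫ x, deriv φ0 x * J x := by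
    rw [← integral_sub (dd _ h1 h2) (dd _ g1 g2)]
    congr 1; ext x
    rw [deriv_sub (h1.differentiable (by simp)).differentiableAt (g1.differentiable (by simp)).differentiableAt]
    ring
  rw [e] at key
  rw [neg_mul, one_div, lt_neg, inv_mul_lt_iff₀ hG] at hlt
  nlinarith

lemma lip_on {f : ℝ → ℝ} {U : Set ℝ} (hU : IsOpen U) (hf : ContDiffOn ℝ 1 f U) {p q : ℝ}
    (hpq : Set.Icc p q ⊆ U) :
    ∃ K, 0 ≤ K ∧ ∀ x ∈ Set.Icc p q, ∀ y ∈ Set.Icc p q, |f y - f x| ≤ K * |y - x| := by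
  have hd : ContinuousOn (deriv f) U := hf.continuousOn_deriv_of_isOpen hU le_rfl
  obtain ⟨K, hK⟩ := isCompact_Icc.exists_bound_of_continuousOn (hd.mono hpq)
  refine ⟨max K 0, le_max_right _ _, fun x hx y hy => ?_⟩
  refine Convex.norm_image_sub_le_of_norm_deriv_le (𝕜 := ℝ) (f := f) (s := Set.Icc p q) ?_ ?_ (convex_Icc p q) hx hy
  · intro z hz
    have hdo : DifferentiableOn ℝ f U := hf.differentiableOn (by simp)
    exact hdo.differentiableAt (hU.mem_nhds (hpq hz))
  · intro z hz
    exact (hK z hz).trans (le_max_left _ _)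

lemma good_of {w : ℝ → ℝ} (hc : ContinuousOn w (Set.Ioo 0 1)) {w0 w1 : ℝ}
    (h0 : Tendsto w (𝓝[Set.Ioo (0:ℝ) 1] 0) (𝓝 w0))
    (h1 : Tendsto w (𝓝[Set.Ioo (0:ℝ) 1] 1) (𝓝 w1)) :
    ∃ M, Good M ((Set.Ioo (0:ℝ) 1).indicator w) := by
  rw [nhdsWithin_Ioo_eq_nhdsGT (by norm_num)] at h0
  rw [nhdsWithin_Ioo_eq_nhdsLT (by norm_num)] at h1
  have hce := continuousOn_Icc_extendFrom_Ioo hc h0 h1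
  obtain ⟨K, hK⟩ := isCompact_Icc.exists_bound_of_continuousOn hce
  refine ⟨max K 0, ⟨?_, ?_, ?_, ?_⟩⟩
  · classical
    rw [← Set.piecewise_eq_indicator]
    exact hc.measurable_piecewise continuousOn_const measurableSet_Ioo
  · intro x
    by_cases hx : x ∈ Set.Ioo (0:ℝ) 1
    · rw [Set.indicator_of_mem hx, ← extendFrom_extends hc x hx]
      exact (hK x ⟨hx.1.le, hx.2.le⟩).trans (le_max_left _ _)
    · rw [Set.indicator_of_notMem hx, abs_zero]; exact le_max_right _ _
  · intro x hx; exact Set.indicator_of_notMem (fun h => absurd h.1 (not_lt.2 hx)) _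
  · intro x hx; exact Set.indicator_of_notMem (fun h => absurd h.2 (not_lt.2 hx)) _

lemma trans_pos {s M B T ε a b : ℝ} {v w : ℝ → ℝ} (hs : 0 < s) (hs1 : s < 1) (hB0 : 0 < B)
    (hB : ∀ z, 0 < z → z < 2 → cv (pker (s - 1)) (pker (-s)) z = B) (hv : Good M v)
    (hw : ContDiffOn ℝ 1 w (Set.Ioo 0 1)) (hvw : ∀ x ∈ Set.Ioo (0:ℝ) 1, v x = w x)
    (hT0 : 0 ≤ T)
    (hT : VarLe (cv (pker (-s)) v) (Set.Ioo 0 1) T)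
    (hε : VarLe (cv (pker (-s)) v) (Set.Ioo 0 a ∪ Set.Ioo b 1) ε)
    (ha : 0 < a) (hab : a ≤ b) (hb : b < 1) :
    ∃ C > 0, ∃ δ > 0, ∀ h, 0 < h → h < δ →
      ∫ x, |v (x + h) - v x| ≤ B⁻¹ * (ε * (2 * (h ^ s / s))) + C * h := by
  have hcont : ∀ x ∈ Set.Ioo (0:ℝ) 1, ContinuousAt v x := by
    intro x hx
    refine (hw.continuousOn.continuousAt (isOpen_Ioo.mem_nhds hx)).congr ?_
    filter_upwards [isOpen_Ioo.mem_nhds hx] with y hy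
    exact (hvw y hy).symm
  have hM := hv.M_nonneg
  obtain ⟨L, hL0, hL⟩ := lip_on isOpen_Ioo hw (p := a / 2) (q := (b + 5) / 6)
    (fun x hx => ⟨by linarith [hx.1], by linarith [hx.2]⟩)
  obtain ⟨K, hK0, hK⟩ := lip_on (f := fun z : ℝ => z ^ (s - 1)) (isOpen_Ioi (a := (0:ℝ)))
    (fun z hz => (Real.contDiffAt_rpow_const_of_ne (ne_of_gt hz)).contDiffWithinAt)
    (p := (1 - b) / 3) (q := 2) (fun x hx => lt_of_lt_of_le (by linarith) hx.1)
  refine ⟨B⁻¹ * (K * T) + 6 * M + L + 1, by positivity, min (a / 4) ((1 - b) / 6),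
    lt_min (by linarith) (by linarith), fun h hh hlt => ?_⟩
  obtain ⟨hha, hhb⟩ := lt_min_iff.1 hlt
  have hE := est_lim hs hs1 hB0 hB hv hcont hT hε ha hab hb hK0 (h := h) (by
    intro z hz hz2
    have hz0 : 0 < z := by linarith
    rw [pker_of_mem (by linarith) hz2, pker_of_mem hz0 (by linarith)]
    have := hK z ⟨hz, by linarith⟩ (z + h) ⟨by linarith, hz2.le⟩
    simpa [abs_of_pos hh] using this) hh hha hhb
  set A := Set.Ioo 0 (a / 2) ∪ Set.Ioo ((b + 2) / 3) (1 - 2 * h) with hA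
  have hAm : MeasurableSet A := measurableSet_Ioo.union measurableSet_Ioo
  set g : ℝ → ℝ := fun x => |v (x + h) - v x| with hg
  have hgi : Integrable g := ((hv.integrable.comp_add_right h).sub hv.integrable).abs
  have hg0 : ∀ x, 0 ≤ g x := fun x => abs_nonneg _
  have hg2 : ∀ x, g x ≤ 2 * M := fun x => by
    have := abs_sub (v (x + h)) (v x)
    have h1 := hv.bdd x
    have h2 := hv.bdd (x + h)
    show |v (x + h) - v x| ≤ _
    linarith
  have ic : ∀ p q c : ℝ, Integrable ((Set.Icc p q).indicator fun _ => c) := fun p q c =>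
    (integrable_indicator_iff measurableSet_Icc).2 (integrableOn_const (by simp))
  have iv : ∀ p q c : ℝ, p ≤ q → ∫ x, (Set.Icc p q).indicator (fun _ => c) x = (q - p) * c := by
    intro p q c hpq
    rw [integral_indicator measurableSet_Icc, setIntegral_const, smul_eq_mul,
      Real.volume_real_Icc_of_le hpq]
  have i0 : ∀ p q c x : ℝ, 0 ≤ c → 0 ≤ (Set.Icc p q).indicator (fun _ => c) x := fun p q c x hc =>
    Set.indicator_nonneg (fun _ _ => hc) x
  have iA := hgi.indicator hAm
  have hpt : ∀ x, g x ≤ (A.indicator g x + (Set.Icc (-h) 0).indicator (fun _ => 2 * M) x)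
      + ((Set.Icc (a / 2) ((b + 2) / 3)).indicator (fun _ => L * h) x
      + (Set.Icc (1 - 2 * h) 1).indicator (fun _ => 2 * M) x) := by
    intro x
    have n0 : 0 ≤ A.indicator g x := Set.indicator_nonneg (fun x _ => hg0 x) x
    have n1 := i0 (-h) 0 (2 * M) x (by positivity)
    have n2 := i0 (a / 2) ((b + 2) / 3) (L * h) x (by positivity)
    have n3 := i0 (1 - 2 * h) 1 (2 * M) x (by positivity)
    by_cases c1 : x < -h
    · have : g x = 0 := by
        show |v (x + h) - v x| = 0
        rw [hv.left _ (by linarith), hv.left _ (by linarith)]; simp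
      linarith
    rw [not_lt] at c1
    by_cases c2 : x ≤ 0
    · have := Set.indicator_of_mem (show x ∈ Set.Icc (-h) 0 from ⟨c1, c2⟩) (fun _ => 2 * M)
      linarith [hg2 x]
    rw [not_le] at c2
    by_cases c3 : x < a / 2
    · have := Set.indicator_of_mem (show x ∈ A from Or.inl ⟨c2, c3⟩) g
      linarith
    rw [not_lt] at c3
    by_cases c4 : x ≤ (b + 2) / 3
    · have := Set.indicator_of_mem (show x ∈ Set.Icc (a / 2) ((b + 2) / 3) from ⟨c3, c4⟩) (fun _ => L * h)
      have h2 : g x ≤ L * h := by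
        show |v (x + h) - v x| ≤ _
        rw [hvw (x + h) ⟨by linarith, by linarith⟩, hvw x ⟨by linarith, by linarith⟩]
        have := hL x ⟨c3, by linarith⟩ (x + h) ⟨by linarith, by linarith⟩
        simpa [abs_of_pos hh] using this
      linarith
    rw [not_le] at c4
    by_cases c5 : x < 1 - 2 * h
    · have := Set.indicator_of_mem (show x ∈ A from Or.inr ⟨c4, c5⟩) g
      linarith
    rw [not_lt] at c5
    by_cases c6 : x ≤ 1
    · have := Set.indicator_of_mem (show x ∈ Set.Icc (1 - 2 * h) 1 from ⟨c5, c6⟩) (fun _ => 2 * M)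
      linarith [hg2 x]
    rw [not_le] at c6
    have : g x = 0 := by
      show |v (x + h) - v x| = 0
      rw [hv.right _ (by linarith), hv.right _ (by linarith)]; simp
    linarith
  have hle := integral_mono hgi ((iA.add (ic (-h) 0 (2 * M))).add
    ((ic (a / 2) ((b + 2) / 3) (L * h)).add (ic (1 - 2 * h) 1 (2 * M)))) hpt
  have hsplit : ∫ x, ((A.indicator g x + (Set.Icc (-h) 0).indicator (fun _ => 2 * M) x)
      + ((Set.Icc (a / 2) ((b + 2) / 3)).indicator (fun _ => L * h) x
      + (Set.Icc (1 - 2 * h) 1).indicator (fun _ => 2 * M) x))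
      = ((∫ x in A, g x) + h * (2 * M)) + (((b + 2) / 3 - a / 2) * (L * h) + 2 * h * (2 * M)) := by
    have j1 : Integrable fun x => A.indicator g x + (Set.Icc (-h) 0).indicator (fun _ => 2 * M) x :=
      iA.add (ic _ _ _)
    have j2 : Integrable fun x => (Set.Icc (a / 2) ((b + 2) / 3)).indicator (fun _ => L * h) x
        + (Set.Icc (1 - 2 * h) 1).indicator (fun _ => 2 * M) x := (ic _ _ _).add (ic _ _ _)
    rw [integral_add j1 j2,
      integral_add iA (ic _ _ _), integral_add (ic _ _ _) (ic _ _ _), integral_indicator hAm,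
      iv _ _ _ (by linarith), iv _ _ _ (by linarith), iv _ _ _ (by linarith)]
    ring
  have hle2 : ∫ x, g x ≤ ((∫ x in A, g x) + h * (2 * M))
      + (((b + 2) / 3 - a / 2) * (L * h) + 2 * h * (2 * M)) := hle.trans (le_of_eq hsplit)
  have hE2 : ∫ x in A, g x ≤ B⁻¹ * (ε * (2 * (h ^ s / s)) + K * h * T) := by
    rw [le_inv_mul_iff₀ hB0]; exact hE
  have hLh : ((b + 2) / 3 - a / 2) * (L * h) ≤ 1 * (L * h) :=
    mul_le_mul_of_nonneg_right (by linarith) (by positivity)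
  refine hle2.trans ?_
  have : B⁻¹ * (ε * (2 * (h ^ s / s)) + K * h * T)
    = B⁻¹ * (ε * (2 * (h ^ s / s))) + B⁻¹ * (K * T) * h := by ring
  linarith

/-- translation estimate for the zero extension of `w ∈ BV^s(I) ∩ C^∞(I)`
with finite boundary values:
`‖τ_h w̃ − w̃‖_{L^1(ℝ)} ≤ |h|^s [1/(Γ(1−s)(1−s)) + 1/Γ(1+s)] (TV^s(w)+‖w‖_{L^∞(∂I)}) + O(|h|)`. -/
theorem translation_estimate_BVs (s : ℝ) (hs : s ∈ Set.Ioo (0:ℝ) 1) (w : ℝ → ℝ)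
    (hsm : ContDiffOn ℝ (⊤ : ℕ∞) w (Set.Ioo 0 1))
    (hL1 : IntegrableOn w (Set.Ioo 0 1))
    (hTV : TV1 s w < ⊤)
    (w0 w1 : ℝ)
    (h0 : Tendsto w (𝓝[Set.Ioo (0:ℝ) 1] 0) (𝓝 w0))
    (h1 : Tendsto w (𝓝[Set.Ioo (0:ℝ) 1] 1) (𝓝 w1)) :
    ∃ C > (0:ℝ), ∃ δ > (0:ℝ), ∀ h : ℝ, 0 < |h| → |h| < δ →
      (∫ x : ℝ, |(Set.Ioo (0:ℝ) 1).indicator w (x + h) - (Set.Ioo (0:ℝ) 1).indicator w x|) ≤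
        |h| ^ s * (1 / (Real.Gamma (1 - s) * (1 - s)) + 1 / Real.Gamma (1 + s)) *
          ((TV1 s w).toReal + max |w0| |w1|) + C * |h| := by
  obtain ⟨hs0, hs1⟩ := hs
  obtain ⟨M, hv⟩ := good_of hsm.continuousOn h0 h1
  obtain ⟨B, hB0, hB⟩ := pker_beta hs0 hs1
  have hG : 0 < Real.Gamma (1 - s) := Real.Gamma_pos_of_pos (by linarith)
  have hG2 : 0 < Real.Gamma (1 + s) := Real.Gamma_pos_of_pos (by linarith)
  have hs2 : 0 < 1 - s := by linarith
  set κ := 1 / (Real.Gamma (1 - s) * (1 - s)) + 1 / Real.Gamma (1 + s) with hκ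
  have hκ0 : 0 < κ := by positivity
  have hVT := varLe_of_TV hs0 hs1 hv hTV
  set T := (TV1 s w).toReal with hTdef
  have hT0 : 0 ≤ T := ENNReal.toReal_nonneg
  obtain ⟨a, b, ε, ha, hab, hb, hεv, hεle⟩ : ∃ a b ε : ℝ, 0 < a ∧ a ≤ b ∧ b < 1 ∧
      VarLe (cv (pker (-s)) ((Set.Ioo (0:ℝ) 1).indicator w)) (Set.Ioo 0 a ∪ Set.Ioo b 1) ε ∧
      B⁻¹ * (ε * (2 / s)) ≤ κ * T := by
    rcases hT0.eq_or_lt with h | h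
    · refine ⟨1/4, 3/4, Real.Gamma (1 - s) * T, by norm_num, by norm_num, by norm_num,
        hVT.mono ?_, ?_⟩
      · exact Set.union_subset (Set.Ioo_subset_Ioo_right (by norm_num))
          (Set.Ioo_subset_Ioo_left (by norm_num))
      · rw [← h]; simp
    · obtain ⟨a, b, ha, hab, hb, hl⟩ := varLe_local hs0 hs1 hv hTV
        (ε := κ * T * s * B / (2 * Real.Gamma (1 - s))) (by positivity) h
      refine ⟨a, b, _, ha, hab, hb, hl, le_of_eq ?_⟩
      field_simp
  obtain ⟨C, hC, δ, hδ, hmain⟩ := trans_pos hs0 hs1 hB0 hB hv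
    (hsm.of_le (by exact_mod_cast le_top)) (fun x hx => Set.indicator_of_mem hx w)
    (by positivity) hVT hεv ha hab hb
  refine ⟨C, hC, δ, hδ, fun h hh hhδ => ?_⟩
  have hsym : (∫ x : ℝ, |(Set.Ioo (0:ℝ) 1).indicator w (x + h) - (Set.Ioo (0:ℝ) 1).indicator w x|)
      = ∫ x : ℝ, |(Set.Ioo (0:ℝ) 1).indicator w (x + |h|) - (Set.Ioo (0:ℝ) 1).indicator w x| := by
    rcases le_or_gt 0 h with h' | h'
    · rw [abs_of_nonneg h']
    · rw [abs_of_neg h', ← integral_add_right_eq_self _ (-h)]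
      congr 1; ext x
      rw [abs_sub_comm, neg_add_cancel_right]
  rw [hsym]
  refine (hmain |h| hh hhδ).trans (add_le_add_left ?_ _)
  have hp : 0 ≤ |h| ^ s := by positivity
  have hm : 0 ≤ max |w0| |w1| := (abs_nonneg _).trans (le_max_left _ _)
  calc B⁻¹ * (ε * (2 * (|h| ^ s / s))) = |h| ^ s * (B⁻¹ * (ε * (2 / s))) := by ring
    _ ≤ |h| ^ s * (κ * T) := mul_le_mul_of_nonneg_left hεle hp
    _ ≤ |h| ^ s * (κ * (T + max |w0| |w1|)) := by gcongr; linarith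
    _ = _ := by ring
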